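/- arXiv:2207.04644 — 2 statements merged into one kernel-verified Lean document; each statement's English description precedes it below -/
import Mathlib

section
/- For all τ in the complex upper half-plane and all z ∈ ℂ: θ_{1,1}(τ,z)² = (1/2)·η(τ)·[ (η(τ)²/(η(τ/2)η(2τ)))²·ϑ00(τ,z) − (η(τ/2)/η(τ))²·ϑ01(τ,z) ]. -/
open Complex

/-- Jacobi theta function `θ_{j,m}(τ,z) = Σ_{n ∈ j/(2m)+ℤ} q^{m n²} e^{2πi m n z}`. -/
noncomputable def jTheta (j m : ℝ) (τ z : ℂ) : ℂ :=
  ∑' n : ℤ, Complex.exp (2 * (Real.pi : ℂ) * Complex.I * (m : ℂ) *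
    (((j / (2 * m) + (n : ℝ) : ℝ) : ℂ) ^ 2 * τ + ((j / (2 * m) + (n : ℝ) : ℝ) : ℂ) * z))

/-- `q^a := e^{2πiaτ}`. -/
noncomputable def qpow (τ : ℂ) (a : ℝ) : ℂ :=
  Complex.exp (2 * (Real.pi : ℂ) * Complex.I * (a : ℂ) * τ)

/-- Dedekind eta function. -/
noncomputable def dedekindEta (τ : ℂ) : ℂ :=
  Complex.exp ((Real.pi : ℂ) * Complex.I * τ / 12) *
    ∏' n : ℕ, (1 - Complex.exp (2 * (Real.pi : ℂ) * Complex.I * ((n : ℂ) + 1) * τ))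

/-- Mumford theta `ϑ00`. -/
noncomputable def v00 (τ z : ℂ) : ℂ := jTheta 0 2 τ z + jTheta 2 2 τ z
/-- Mumford theta `ϑ01`. -/
noncomputable def v01 (τ z : ℂ) : ℂ := jTheta 0 2 τ z - jTheta 2 2 τ z
/-- Mumford theta `ϑ10`. -/
noncomputable def v10 (τ z : ℂ) : ℂ := jTheta 1 2 τ z + jTheta (-1) 2 τ z

open Filter Topology Finset

/-- The Gaussian binomial coefficient `[n choose k]` evaluated at `q`. -/
def gaussBinom (q : ℂ) : ℕ → ℕ → ℂ
  | _, 0 => 1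
  | 0, _ + 1 => 0
  | n + 1, k + 1 => gaussBinom q n k + q ^ (k + 1) * gaussBinom q n (k + 1)

lemma gaussBinom_zero_right (q : ℂ) (n : ℕ) : gaussBinom q n 0 = 1 := by
  cases n <;> rfl

lemma gaussBinom_succ_succ (q : ℂ) (n k : ℕ) :
    gaussBinom q (n + 1) (k + 1) = gaussBinom q n k + q ^ (k + 1) * gaussBinom q n (k + 1) := rfl

lemma gaussBinom_eq_zero_of_lt (q : ℂ) {n k : ℕ} (h : n < k) : gaussBinom q n k = 0 := by
  induction n generalizing k with
  | zero => obtain ⟨k, rfl⟩ := Nat.exists_eq_succ_of_ne_zero h.ne'; rfl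
  | succ n ih =>
    obtain ⟨k, rfl⟩ := Nat.exists_eq_succ_of_ne_zero (by lia : k ≠ 0)
    rw [Nat.succ_eq_add_one, gaussBinom_succ_succ, ih (by lia), ih (by lia)]
    simp

/-- The finite Euler product `∏_{k < n} (1 - q^(k+1))`. -/
def eulerPartialProd (q : ℂ) (n : ℕ) : ℂ := ∏ k ∈ range n, (1 - q ^ (k + 1))

/-- The Euler product `∏_{k} (1 - q^(k+1))`. -/
noncomputable def eulerProd (q : ℂ) : ℂ := ∏' k : ℕ, (1 - q ^ (k + 1))

/-- The product `∏_{k} (1 - q^(2k+1))`. -/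
noncomputable def oddEulerProd (q : ℂ) : ℂ := ∏' k : ℕ, (1 - q ^ (2 * k + 1))

lemma gaussBinom_mul_eulerPartialProd (q : ℂ) (n k : ℕ) :
    gaussBinom q (n + k) k * (eulerPartialProd q k * eulerPartialProd q n)
      = eulerPartialProd q (n + k) := by
  induction k generalizing n with
  | zero => simp [gaussBinom_zero_right, eulerPartialProd]
  | succ k ihk =>
    induction n with
    | zero =>
      have h := ihk 0
      rw [← add_assoc, gaussBinom_succ_succ, gaussBinom_eq_zero_of_lt q (by lia : 0 + k < k + 1)]
      simp only [eulerPartialProd, prod_range_succ, zero_add, range_zero, prod_empty] at h ⊢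
      linear_combination (1 - q ^ (k + 1)) * h
    | succ n ihn =>
      have h := ihk (n + 1)
      rw [← add_assoc, gaussBinom_succ_succ]
      rw [show n + 1 + k = n + (k + 1) by ring] at h ⊢
      simp only [eulerPartialProd, prod_range_succ] at h ihn ⊢
      rw [← add_assoc, prod_range_succ] at h ihn ⊢
      linear_combination (1 - q ^ (k + 1)) * h + q ^ (k + 1) * (1 - q ^ (n + 1)) * ihn

lemma prod_one_add_mul_pow_odd (x y : ℂ) (n : ℕ) :
    ∏ k ∈ range n, (1 + y * x ^ (2 * k + 1))
      = ∑ k ∈ range (n + 1), x ^ (k ^ 2) * gaussBinom (x ^ 2) n k * y ^ k := by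
  induction n generalizing y with
  | zero => simp [gaussBinom_zero_right]
  | succ n ih =>
    have hs : ∑ k ∈ range (n + 1), x ^ (k ^ 2) * gaussBinom (x ^ 2) n k * (y * x ^ 2) ^ k
        = ∑ k ∈ range (n + 1),
            x ^ ((k + 1) ^ 2) * gaussBinom (x ^ 2) n (k + 1) * (y * x ^ 2) ^ (k + 1) + 1 := by
      have h := sum_range_succ'
        (fun k ↦ x ^ (k ^ 2) * gaussBinom (x ^ 2) n k * (y * x ^ 2) ^ k) (n + 1)
      rw [sum_range_succ, gaussBinom_eq_zero_of_lt _ (Nat.lt_succ_self n)] at h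
      simpa [gaussBinom_zero_right] using h
    rw [prod_range_succ', prod_congr rfl (g := fun k ↦ 1 + y * x ^ 2 * x ^ (2 * k + 1))
      fun k _ ↦ by ring, ih (y * x ^ 2), mul_add, mul_one]
    nth_rw 1 [hs]
    rw [sum_range_succ' _ (n + 1), sum_mul, add_right_comm, ← sum_add_distrib]
    congr 1
    · refine sum_congr rfl fun k _ ↦ ?_
      rw [gaussBinom_succ_succ]
      ring
    · simp [gaussBinom_zero_right]

lemma prod_one_sub_pow_odd_sq {x : ℂ} (hx : x ≠ 0) (n : ℕ) :
    (∏ k ∈ range n, (1 - x ^ (2 * k + 1))) ^ 2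
      = ∑ k ∈ range (2 * n + 1),
          (-1) ^ (k + n) * x ^ (((k : ℤ) - n).natAbs ^ 2) * gaussBinom (x ^ 2) (2 * n) k := by
  have h := prod_one_add_mul_pow_odd x (-(x ^ (2 * n))⁻¹) (2 * n)
  rw [two_mul n, prod_range_add, ← two_mul, ← prod_range_reflect] at h
  have h1 : ∏ k ∈ range n, (1 + -(x ^ (2 * n))⁻¹ * x ^ (2 * (n + k) + 1))
      = ∏ k ∈ range n, (1 - x ^ (2 * k + 1)) := by
    refine prod_congr rfl fun k _ ↦ ?_
    field_simp
    ring
  have h2 : ∏ k ∈ range n, (1 + -(x ^ (2 * n))⁻¹ * x ^ (2 * (n - 1 - k) + 1))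
      = (-1) ^ n * (x ^ (n ^ 2))⁻¹ * ∏ k ∈ range n, (1 - x ^ (2 * k + 1)) := by
    have h3 : ∏ k ∈ range n, x ^ (2 * k + 1) = x ^ (n ^ 2) := by
      rw [prod_pow_eq_pow_sum]
      congr 1
      clear h h1
      induction n with
      | zero => rfl
      | succ n ih => rw [sum_range_succ, ih]; ring
    have h4 : (-1 : ℂ) ^ n * (x ^ (n ^ 2))⁻¹ = ∏ k ∈ range n, (-(x ^ (2 * k + 1))⁻¹) := by
      rw [prod_neg, prod_inv_distrib, h3, card_range]
    rw [h4, ← prod_mul_distrib]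
    refine prod_congr rfl fun k hk ↦ ?_
    obtain ⟨m, rfl⟩ := Nat.exists_eq_add_of_lt (mem_range.mp hk)
    rw [show k + m + 1 - 1 - k = m by lia]
    field_simp
    ring
  rw [h1, h2] at h
  have h5 : (∏ k ∈ range n, (1 - x ^ (2 * k + 1))) ^ 2 = (-1) ^ n * x ^ (n ^ 2) *
      ((-1) ^ n * (x ^ (n ^ 2))⁻¹ * (∏ k ∈ range n, (1 - x ^ (2 * k + 1))) *
        ∏ k ∈ range n, (1 - x ^ (2 * k + 1))) := by
    have : ((-1 : ℂ) ^ n) ^ 2 = 1 := by rw [← pow_mul, mul_comm, pow_mul]; simp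
    field_simp
    rw [this, mul_one]
  rw [h5, h, mul_sum]
  refine sum_congr rfl fun k _ ↦ ?_
  have h6 : x ^ (((k : ℤ) - n).natAbs ^ 2) * x ^ (2 * n * k) = x ^ (n ^ 2) * x ^ (k ^ 2) := by
    rw [← pow_add, ← pow_add]
    congr 1
    zify
    rw [sq_abs]
    ring
  rw [neg_pow (x ^ (2 * n))⁻¹, inv_pow, ← pow_mul, pow_add]
  field_simp
  linear_combination -gaussBinom (x ^ 2) (2 * n) k * h6

lemma summable_norm_pow_natAbs_sq {x : ℂ} (hx : ‖x‖ < 1) :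
    Summable fun j : ℤ ↦ ‖x‖ ^ (j.natAbs ^ 2) := by
  have h : Summable fun n : ℕ ↦ ‖x‖ ^ (n ^ 2) :=
    (summable_geometric_of_lt_one (norm_nonneg x) hx).of_nonneg_of_le (fun n ↦ by positivity)
      fun n ↦ pow_le_pow_of_le_one (norm_nonneg x) hx.le (Nat.le_self_pow two_ne_zero n)
  exact .of_nat_of_neg (by simpa using h) (by simpa using h)

lemma one_sub_pow_ne_zero {q : ℂ} (hq : ‖q‖ < 1) (k : ℕ) : 1 - q ^ (k + 1) ≠ 0 := by
  intro h
  have h' : ‖q‖ ^ (k + 1) = 1 := by rw [← norm_pow, ← sub_eq_zero.mp h, norm_one]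
  exact (pow_lt_one₀ (norm_nonneg q) hq k.succ_ne_zero).ne h'

lemma eulerPartialProd_ne_zero {q : ℂ} (hq : ‖q‖ < 1) (n : ℕ) : eulerPartialProd q n ≠ 0 :=
  prod_ne_zero_iff.mpr fun k _ ↦ one_sub_pow_ne_zero hq k

lemma eulerProd_ne_zero {q : ℂ} (hq : ‖q‖ < 1) : eulerProd q ≠ 0 := by
  refine tprod_one_add_ne_zero_of_summable (f := fun n : ℕ ↦ -q ^ (n + 1)) ?_ ?_
  · exact fun k ↦ by simpa [sub_eq_add_neg] using one_sub_pow_ne_zero hq k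
  · simpa using (summable_nat_add_iff 1).mpr (summable_geometric_of_lt_one (norm_nonneg _) hq)

lemma tendsto_eulerPartialProd {q : ℂ} (hq : ‖q‖ < 1) :
    Tendsto (eulerPartialProd q) atTop (𝓝 (eulerProd q)) :=
  (ModularForm.multipliable_one_sub_pow hq).hasProd.tendsto_prod_nat

lemma multipliable_one_sub_pow_odd {q : ℂ} (hq : ‖q‖ < 1) :
    Multipliable fun k : ℕ ↦ 1 - q ^ (2 * k + 1) := by
  apply multipliable_one_add_of_summable (f := fun n : ℕ ↦ -q ^ (2 * n + 1))
  simpa [Function.comp_def] using (summable_geometric_of_lt_one (norm_nonneg _) hq).comp_injective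
    (i := fun n : ℕ ↦ 2 * n + 1) fun a b h ↦ by simpa using h

lemma eulerProd_eq_mul_oddEulerProd {q : ℂ} (hq : ‖q‖ < 1) :
    eulerProd q = oddEulerProd q * eulerProd (q ^ 2) := by
  have hq2 : ‖q ^ 2‖ < 1 := by
    rw [norm_pow]; exact pow_lt_one₀ (norm_nonneg q) hq two_ne_zero
  have h : ∀ k : ℕ, (q ^ 2) ^ (k + 1) = q ^ (2 * k + 1 + 1) := fun k ↦ by ring
  have := ModularForm.multipliable_one_sub_pow hq2
  simp_rw [h] at this
  rw [eulerProd, oddEulerProd, eulerProd,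
    ← tprod_even_mul_odd (f := fun k ↦ 1 - q ^ (k + 1)) (multipliable_one_sub_pow_odd hq) this]
  simp_rw [h]

lemma oddEulerProd_mul_neg {q : ℂ} (hq : ‖q‖ < 1) :
    oddEulerProd q * oddEulerProd (-q) = oddEulerProd (q ^ 2) := by
  rw [oddEulerProd, oddEulerProd, ← (multipliable_one_sub_pow_odd hq).tprod_mul
    (multipliable_one_sub_pow_odd (by simpa using hq))]
  refine tprod_congr fun k ↦ ?_
  rw [Odd.neg_pow ⟨k, rfl⟩]
  ring

lemma exists_norm_gaussBinom_le {q : ℂ} (hq : ‖q‖ < 1) :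
    ∃ C : ℝ, 0 ≤ C ∧ ∀ n k, ‖gaussBinom q n k‖ ≤ C := by
  obtain ⟨A, hA⟩ := (tendsto_eulerPartialProd hq).norm.bddAbove_range
  obtain ⟨B, hB⟩ := ((tendsto_eulerPartialProd hq).inv₀ (eulerProd_ne_zero hq)).norm.bddAbove_range
  have hA' n : ‖eulerPartialProd q n‖ ≤ A := hA ⟨n, rfl⟩
  have hB' n : ‖(eulerPartialProd q n)⁻¹‖ ≤ B := hB ⟨n, rfl⟩
  have hA0 : 0 ≤ A := (norm_nonneg _).trans (hA' 0)
  have hB0 : 0 ≤ B := (norm_nonneg _).trans (hB' 0)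
  refine ⟨A * (B * B), by positivity, fun n k ↦ ?_⟩
  rcases lt_or_ge n k with h | h
  · rw [gaussBinom_eq_zero_of_lt q h, norm_zero]
    positivity
  · obtain ⟨m, rfl⟩ := Nat.exists_eq_add_of_le' h
    rw [eq_div_of_mul_eq (mul_ne_zero (eulerPartialProd_ne_zero hq k)
      (eulerPartialProd_ne_zero hq m)) (gaussBinom_mul_eulerPartialProd q m k), div_eq_mul_inv,
      mul_inv, norm_mul, norm_mul]
    gcongr
    exacts [hA' _, hB' _, hB' _]

lemma tendsto_gaussBinom_central {q : ℂ} (hq : ‖q‖ < 1) (j : ℤ) :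
    Tendsto (fun n : ℕ ↦ gaussBinom q (2 * n) (j + n).toNat) atTop (𝓝 (eulerProd q)⁻¹) := by
  have hP := tendsto_eulerPartialProd hq
  have hP0 := eulerProd_ne_zero hq
  have ht (i : ℤ) : Tendsto (fun n : ℕ ↦ (i + n).toNat) atTop atTop :=
    tendsto_atTop_mono (f := fun n ↦ n - i.natAbs) (fun n ↦ by lia) (tendsto_sub_atTop_nat _)
  have h := (hP.comp (tendsto_id.const_mul_atTop' two_pos)).div
    ((hP.comp (ht j)).mul (hP.comp (ht (-j)))) (mul_ne_zero hP0 hP0)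
  rw [div_mul_cancel_left₀ hP0] at h
  refine h.congr' ?_
  filter_upwards [eventually_ge_atTop j.natAbs] with n hn
  have h1 := gaussBinom_mul_eulerPartialProd q (-j + n).toNat (j + n).toNat
  rw [show (-j + n).toNat + (j + n).toNat = 2 * n by lia] at h1
  exact (eq_div_of_mul_eq (mul_ne_zero (eulerPartialProd_ne_zero hq _)
    (eulerPartialProd_ne_zero hq _)) h1).symm

/-- Gauss's identity, the case `z = -1` of the Jacobi triple product. -/
lemma tsum_neg_one_pow_mul_pow_sq {x : ℂ} (hx0 : x ≠ 0) (hx : ‖x‖ < 1) :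
    ∑' j : ℤ, (-1) ^ j.natAbs * x ^ (j.natAbs ^ 2)
      = oddEulerProd x ^ 2 * eulerProd (x ^ 2) := by
  have hx2 : ‖x ^ 2‖ < 1 := by
    rw [norm_pow]; exact pow_lt_one₀ (norm_nonneg x) hx two_ne_zero
  let F (n : ℕ) (j : ℤ) : ℂ := if -(n : ℤ) ≤ j then
    (-1) ^ j.natAbs * x ^ (j.natAbs ^ 2) * gaussBinom (x ^ 2) (2 * n) (j + n).toNat else 0
  have hF (n : ℕ) : ∑' j, F n j = (∏ k ∈ range n, (1 - x ^ (2 * k + 1))) ^ 2 := by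
    rw [prod_one_sub_pow_odd_sq hx0, tsum_eq_sum
      (s := (range (2 * n + 1)).map ⟨fun k : ℕ ↦ (k : ℤ) - n, fun a b h ↦ by simpa using h⟩)]
    · rw [sum_map]
      refine sum_congr rfl fun k _ ↦ ?_
      have : (-1 : ℂ) ^ ((k : ℤ) - n).natAbs = (-1) ^ (k + n) := by
        rw [neg_one_pow_eq_pow_mod_two, neg_one_pow_eq_pow_mod_two (k + n)]
        congr 1
        lia
      change F n ((k : ℤ) - n) = _
      simp only [F]
      rw [if_pos (by lia), this, sub_add_cancel, Int.toNat_natCast]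
    · intro j hj
      simp only [F]
      split_ifs with h
      · rw [gaussBinom_eq_zero_of_lt, mul_zero]
        by_contra! h'
        refine hj (mem_map.mpr ⟨(j + n).toNat, mem_range.mpr (by lia), ?_⟩)
        change (((j + n).toNat : ℕ) : ℤ) - n = j
        lia
      · rfl
  obtain ⟨C, hC0, hC⟩ := exists_norm_gaussBinom_le hx2
  have hlim : Tendsto (fun n ↦ ∑' j, F n j) atTop
      (𝓝 (∑' j : ℤ, (-1) ^ j.natAbs * x ^ (j.natAbs ^ 2) * (eulerProd (x ^ 2))⁻¹)) := by
    refine tendsto_tsum_of_dominated_convergence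
      ((summable_norm_pow_natAbs_sq hx).mul_right C) (fun j ↦ ?_) (.of_forall fun n j ↦ ?_)
    · refine ((tendsto_gaussBinom_central hx2 j).const_mul _).congr' ?_
      filter_upwards [eventually_ge_atTop j.natAbs] with n hn
      simp only [F]
      rw [if_pos (by lia)]
    · simp only [F]
      split_ifs
      · rw [norm_mul, norm_mul, norm_pow, norm_pow, norm_neg, norm_one, one_pow, one_mul]
        gcongr
        exact hC _ _
      · rw [norm_zero]
        positivity
  simp_rw [hF] at hlim
  have h := tendsto_nhds_unique hlim
    ((multipliable_one_sub_pow_odd hx).hasProd.tendsto_prod_nat.pow 2)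
  rw [tsum_mul_right, ← div_eq_mul_inv, div_eq_iff (eulerProd_ne_zero hx2)] at h
  exact h

lemma HasSum.of_bijective_sumElim {ι κ γ : Type*} {f : γ → ℂ} {u : ι → γ} {v : κ → γ} {a b : ℂ}
    (huv : Function.Bijective (Sum.elim u v)) (hu : HasSum (f ∘ u) a) (hv : HasSum (f ∘ v) b) :
    HasSum f (a + b) :=
  (Equiv.ofBijective _ huv).hasSum_iff.mp (HasSum.sum (f := f ∘ Sum.elim u v) hu hv)

lemma bijective_sumElim_even_odd :
    Function.Bijective (Sum.elim (fun n : ℤ ↦ 2 * n) fun n : ℤ ↦ 2 * n + 1) := by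
  constructor
  · rintro (a | a) (b | b) h <;> simp only [Sum.elim_inl, Sum.elim_inr] at h <;>
      first | (exfalso; lia) | (congr 1; lia)
  · intro n
    rcases Int.even_or_odd' n with ⟨k, h | h⟩
    exacts [⟨.inl k, h.symm⟩, ⟨.inr k, h.symm⟩]

lemma bijective_sumElim_add_sub :
    Function.Bijective (Sum.elim (fun p : ℤ × ℤ ↦ (p.1 + p.2, p.1 - p.2 - 1))
      fun p : ℤ × ℤ ↦ (p.1 + p.2, p.1 - p.2)) := by
  constructor
  · rintro (⟨a, b⟩ | ⟨a, b⟩) (⟨c, d⟩ | ⟨c, d⟩) h <;>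
      simp only [Sum.elim_inl, Sum.elim_inr, Prod.mk.injEq] at h <;>
      first | (exfalso; lia) | (congr 2 <;> lia)
  · rintro ⟨a, b⟩
    rcases Int.even_or_odd' (a + b) with ⟨k, h | h⟩
    · exact ⟨.inr (k, a - k), Prod.ext (by simp) (by simp; lia)⟩
    · exact ⟨.inl (k + 1, a - k - 1), Prod.ext (by simp) (by simp; lia)⟩

/-- The general term of the series defining `jTheta`. -/
noncomputable def jThetaTerm (j m : ℝ) (τ z : ℂ) (n : ℤ) : ℂ :=
  cexp (2 * (Real.pi : ℂ) * I * (m : ℂ) *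
    (((j / (2 * m) + (n : ℝ) : ℝ) : ℂ) ^ 2 * τ + ((j / (2 * m) + (n : ℝ) : ℝ) : ℂ) * z))

lemma summable_jThetaTerm (j : ℝ) {m : ℝ} (hm : 0 < m) {τ : ℂ} (hτ : 0 < τ.im) (z : ℂ) :
    Summable (jThetaTerm j m τ z) := by
  have h := (summable_jacobiTheta₂_term_iff
    (2 * m * (j / (2 * m) : ℝ) * τ + m * z) ((2 * m : ℝ) * τ)).mpr
      (by rw [im_ofReal_mul]; positivity)
  refine (h.mul_left (cexp (2 * Real.pi * I * m *
    ((j / (2 * m) : ℝ) ^ 2 * τ + (j / (2 * m) : ℝ) * z)))).congr fun n ↦ ?_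
  rw [jacobiTheta₂_term, jThetaTerm, ← Complex.exp_add]
  congr 1
  push_cast
  ring

lemma hasSum_jTheta (j : ℝ) {m : ℝ} (hm : 0 < m) {τ : ℂ} (hτ : 0 < τ.im) (z : ℂ) :
    HasSum (jThetaTerm j m τ z) (jTheta j m τ z) :=
  (summable_jThetaTerm j hm hτ z).hasSum

lemma hasSum_jTheta_mul {j m j' m' : ℝ} (hm : 0 < m) (hm' : 0 < m') {τ : ℂ} (hτ : 0 < τ.im)
    (z z' : ℂ) :
    HasSum (fun p : ℤ × ℤ ↦ jThetaTerm j m τ z p.1 * jThetaTerm j' m' τ z' p.2)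
      (jTheta j m τ z * jTheta j' m' τ z') :=
  (hasSum_jTheta j hm hτ z).mul (hasSum_jTheta j' hm' hτ z')
    (summable_mul_of_summable_norm (summable_jThetaTerm j hm hτ z).norm
      (summable_jThetaTerm j' hm' hτ z').norm)

lemma jTheta_one_one_sq {τ : ℂ} (hτ : 0 < τ.im) (z : ℂ) :
    jTheta 1 1 τ z ^ 2
      = jTheta 0 2 τ z * jTheta 2 2 τ 0 + jTheta 2 2 τ z * jTheta 0 2 τ 0 := by
  rw [sq]
  refine (hasSum_jTheta_mul one_pos one_pos hτ z z).unique
    (.of_bijective_sumElim bijective_sumElim_add_sub ?_ ?_)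
  · convert hasSum_jTheta_mul (j := 0) (j' := 2) two_pos two_pos hτ z 0 using 1
    ext p
    simp only [Function.comp_apply, jThetaTerm, ← Complex.exp_add]
    congr 1
    push_cast
    ring
  · convert hasSum_jTheta_mul (j := 2) (j' := 0) two_pos two_pos hτ z 0 using 1
    ext p
    simp only [Function.comp_apply, jThetaTerm, ← Complex.exp_add]
    congr 1
    push_cast
    ring

lemma Complex.exp_pi_mul_I_pow_natAbs_sq (τ : ℂ) (n : ℤ) :
    cexp (Real.pi * I * τ) ^ (n.natAbs ^ 2) = cexp (Real.pi * I * τ * n ^ 2) := by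
  rw [← Complex.exp_nat_mul, mul_comm]
  congr 2
  rw [Nat.cast_pow, Nat.cast_natAbs, ← Int.cast_pow, sq_abs, Int.cast_pow]

lemma jThetaTerm_zero_two (τ : ℂ) (n : ℤ) :
    jThetaTerm 0 2 τ 0 n = cexp (Real.pi * I * τ) ^ ((2 * n).natAbs ^ 2) := by
  rw [exp_pi_mul_I_pow_natAbs_sq, jThetaTerm]
  congr 1
  push_cast
  ring

lemma jThetaTerm_two_two (τ : ℂ) (n : ℤ) :
    jThetaTerm 2 2 τ 0 n = cexp (Real.pi * I * τ) ^ ((2 * n + 1).natAbs ^ 2) := by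
  rw [exp_pi_mul_I_pow_natAbs_sq, jThetaTerm]
  congr 1
  push_cast
  ring

lemma hasSum_v00 {τ : ℂ} (hτ : 0 < τ.im) :
    HasSum (fun n : ℤ ↦ cexp (Real.pi * I * τ) ^ (n.natAbs ^ 2)) (v00 τ 0) :=
  .of_bijective_sumElim bijective_sumElim_even_odd
    ((hasSum_jTheta 0 two_pos hτ 0).congr_fun fun n ↦ (jThetaTerm_zero_two τ n).symm)
    ((hasSum_jTheta 2 two_pos hτ 0).congr_fun fun n ↦ (jThetaTerm_two_two τ n).symm)

lemma hasSum_v01 {τ : ℂ} (hτ : 0 < τ.im) :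
    HasSum (fun n : ℤ ↦ (-1) ^ n.natAbs * cexp (Real.pi * I * τ) ^ (n.natAbs ^ 2)) (v01 τ 0) := by
  rw [v01, sub_eq_add_neg]
  refine .of_bijective_sumElim bijective_sumElim_even_odd ?_ ?_
  · convert hasSum_jTheta 0 two_pos hτ 0 using 1
    ext n
    rw [jThetaTerm_zero_two, Function.comp_apply, (Int.natAbs_even.mpr (even_two_mul n)).neg_one_pow,
      one_mul]
  · refine (hasSum_jTheta 2 two_pos hτ 0).neg.congr_fun fun n ↦ ?_
    rw [jThetaTerm_two_two, Function.comp_apply,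
      (Int.natAbs_odd.mpr (odd_two_mul_add_one n)).neg_one_pow, neg_one_mul]

lemma norm_exp_pi_mul_I_lt_one {τ : ℂ} (hτ : 0 < τ.im) : ‖cexp (Real.pi * I * τ)‖ < 1 := by
  rw [Complex.norm_exp, Real.exp_lt_one_iff]
  simp
  positivity

lemma v01_zero {τ : ℂ} (hτ : 0 < τ.im) :
    v01 τ 0 = oddEulerProd (cexp (Real.pi * I * τ)) ^ 2 * eulerProd (cexp (Real.pi * I * τ) ^ 2) :=
  (hasSum_v01 hτ).tsum_eq.symm.trans
    (tsum_neg_one_pow_mul_pow_sq (Complex.exp_ne_zero _) (norm_exp_pi_mul_I_lt_one hτ))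

lemma v00_zero {τ : ℂ} (hτ : 0 < τ.im) :
    v00 τ 0
      = oddEulerProd (-cexp (Real.pi * I * τ)) ^ 2 * eulerProd (cexp (Real.pi * I * τ) ^ 2) := by
  rw [← (hasSum_v00 hτ).tsum_eq, ← neg_sq (cexp (Real.pi * I * τ)),
    ← tsum_neg_one_pow_mul_pow_sq (neg_ne_zero.mpr (Complex.exp_ne_zero _))
      (by simpa using norm_exp_pi_mul_I_lt_one hτ)]
  refine tsum_congr fun n ↦ ?_
  rw [neg_pow (cexp _), ← mul_assoc, ← pow_add, Even.neg_one_pow, one_mul]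
  rw [sq, ← mul_one_add (n.natAbs), add_comm]
  exact Nat.even_mul_succ_self n.natAbs

lemma dedekindEta_eq (τ : ℂ) :
    dedekindEta τ = cexp (Real.pi * I * τ / 12) * eulerProd (cexp (2 * Real.pi * I * τ)) := by
  rw [dedekindEta, eulerProd]
  congr 1
  refine tprod_congr fun n ↦ ?_
  rw [← Complex.exp_nat_mul]
  congr 2
  push_cast
  ring

/-- Note 2.4 (2): `θ_{1,1}(τ,z)²`. -/
theorem stmt_11 (τ : ℂ) (hτ : 0 < τ.im) (z : ℂ) :
    jTheta 1 1 τ z ^ 2 =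
      (1 / 2) * dedekindEta τ *
        ((dedekindEta τ ^ 2 / (dedekindEta (τ / 2) * dedekindEta (2 * τ))) ^ 2 * v00 τ z
          - (dedekindEta (τ / 2) / dedekindEta τ) ^ 2 * v01 τ z) := by
  set x := cexp (Real.pi * I * τ) with hx_def
  set e := cexp (Real.pi * I * τ / 24) with he_def
  have hx : ‖x‖ < 1 := norm_exp_pi_mul_I_lt_one hτ
  have hx2 : ‖x ^ 2‖ < 1 := by rw [norm_pow]; exact pow_lt_one₀ (norm_nonneg x) hx two_ne_zero
  have hx4 : ‖(x ^ 2) ^ 2‖ < 1 := by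
    rw [norm_pow]; exact pow_lt_one₀ (norm_nonneg _) hx2 two_ne_zero
  have h1 : dedekindEta τ = e ^ 2 * eulerProd (x ^ 2) := by
    rw [dedekindEta_eq, he_def, hx_def, ← Complex.exp_nat_mul, ← Complex.exp_nat_mul]
    push_cast
    ring_nf
  have h2 : dedekindEta (τ / 2) = e * eulerProd x := by
    rw [dedekindEta_eq, he_def, hx_def]
    ring_nf
  have h4 : dedekindEta (2 * τ) = e ^ 4 * eulerProd ((x ^ 2) ^ 2) := by
    rw [dedekindEta_eq, he_def, hx_def, ← Complex.exp_nat_mul, ← Complex.exp_nat_mul,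
      ← Complex.exp_nat_mul]
    push_cast
    ring_nf
  have he : e ≠ 0 := Complex.exp_ne_zero _
  have p1 := eulerProd_ne_zero hx
  have p2 := eulerProd_ne_zero hx2
  have p4 := eulerProd_ne_zero hx4
  have r1 := eulerProd_eq_mul_oddEulerProd hx
  have r2 := eulerProd_eq_mul_oddEulerProd hx2
  rw [← oddEulerProd_mul_neg hx] at r2
  have o1 : oddEulerProd x ≠ 0 := left_ne_zero_of_mul (r1 ▸ p1)
  have k01 : dedekindEta τ * (dedekindEta (τ / 2) / dedekindEta τ) ^ 2 = v01 τ 0 := by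
    rw [v01_zero hτ, ← hx_def, h1, h2, r1]
    field_simp
  have k00 : dedekindEta τ * (dedekindEta τ ^ 2 / (dedekindEta (τ / 2) * dedekindEta (2 * τ))) ^ 2
      = v00 τ 0 := by
    have o2 : oddEulerProd (-x)
        = eulerProd (x ^ 2) / (oddEulerProd x * eulerProd ((x ^ 2) ^ 2)) := by
      rw [eq_div_iff (mul_ne_zero o1 p4)]
      linear_combination -r2
    rw [v00_zero hτ, ← hx_def, h1, h2, h4, o2, r1]
    generalize eulerProd ((x ^ 2) ^ 2) = P at p4
    field_simp
  rw [jTheta_one_one_sq hτ, mul_assoc, mul_sub, ← mul_assoc, ← mul_assoc (dedekindEta τ), k00, k01]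
  simp only [v00, v01]
  ring
end

section
/- For every integer m ≥ 1, every k ∈ (1/2)ℤ, all τ in the complex upper half-plane, and all z ∈ ℂ: [θ_{1,2}(τ,z) + θ_{−1,2}(τ,z)]·θ_{k,m}(τ,z) = Σ_{r=0}^{2(m+2)−1} θ_{k−1+2r, m+2}(τ,z) · θ_{2k+m−2mr, 2m(m+2)}(τ,0) (the summand is independent of the choice of representative r modulo 2(m+2)). -/
open Complex

/-- The exponential `e^{2πi m (x² τ + x z)}` occurring in the theta function of level `m`. -/
noncomputable def thetaTerm (m : ℝ) (τ z : ℂ) (x : ℝ) : ℂ :=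
  Complex.exp (2 * (Real.pi : ℂ) * Complex.I * (m : ℂ) * ((x : ℂ) ^ 2 * τ + (x : ℂ) * z))

theorem jTheta_eq_tsum_thetaTerm (j m : ℝ) (τ z : ℂ) :
    jTheta j m τ z = ∑' n : ℤ, thetaTerm m τ z (j / (2 * m) + n) := rfl

theorem summable_thetaTerm {m : ℝ} (hm : 0 < m) {τ : ℂ} (hτ : 0 < τ.im) (z : ℂ) (c : ℝ) :
    Summable fun n : ℤ => thetaTerm m τ z (c + n) := by
  have h : Summable fun n : ℤ => jacobiTheta₂_term n (m * (2 * c * τ + z)) (2 * m * τ) := by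
    rw [summable_jacobiTheta₂_term_iff]
    have : (2 * (m : ℂ) * τ).im = 2 * m * τ.im := by simp
    rw [this]
    positivity
  refine (h.mul_left (thetaTerm m τ z c)).congr fun n => ?_
  rw [thetaTerm, thetaTerm, jacobiTheta₂_term, ← Complex.exp_add]
  congr 1
  push_cast
  ring

/-- The parametrisation of `ℤ × ℤ` by a residue `r` modulo `2 (m + 2)` and two integers
`p`, `s`. -/
def latticeEquiv (m : ℕ) : Fin (2 * (m + 2)) × ℤ × ℤ ≃ ℤ × ℤ where
  toFun x := ((x.1 : ℕ) + 2 * x.2.1 - 2 * m * x.2.2 - 1, x.2.1 + 2 * x.2.2)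
  invFun y := ((Int.divModEquiv (2 * (m + 2)) (y.1 + 1 - 2 * y.2)).2,
    y.2 + 2 * (Int.divModEquiv (2 * (m + 2)) (y.1 + 1 - 2 * y.2)).1,
    -(Int.divModEquiv (2 * (m + 2)) (y.1 + 1 - 2 * y.2)).1)
  left_inv := by
    rintro ⟨r, p, s⟩
    have h : ((r : ℕ) : ℤ) + 2 * p - 2 * m * s - 1 + 1 - 2 * (p + 2 * s) =
        (Int.divModEquiv (2 * (m + 2))).symm (-s, r) := by
      simp [Int.divModEquiv]
      ring
    simp only [h, Equiv.apply_symm_apply]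
    simp
  right_inv := by
    rintro ⟨l, n⟩
    obtain ⟨⟨q, r⟩, h⟩ := (Int.divModEquiv (2 * (m + 2))).symm.surjective (l + 1 - 2 * n)
    simp only [← h, Equiv.apply_symm_apply]
    simp [Int.divModEquiv] at h
    ext
    · simp only
      linear_combination h
    · simp

theorem HasSum.int_even_add_odd {f : ℤ → ℂ} {a b : ℂ} (he : HasSum (fun n => f (2 * n)) a)
    (ho : HasSum (fun n => f (2 * n + 1)) b) : HasSum f (a + b) := by
  have h := mul_right_injective₀ (two_ne_zero' ℤ)
  replace ho := ((add_left_injective 1).comp h).hasSum_range_iff.2 ho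
  refine (h.hasSum_range_iff.2 he).add_isCompl ?_ ho
  simpa [Function.comp_def] using Int.isCompl_even_odd

theorem hasSum_thetaTerm_odd {τ : ℂ} (hτ : 0 < τ.im) (z : ℂ) :
    HasSum (fun l : ℤ => thetaTerm 2 τ z ((2 * l + 1) / 4))
      (jTheta 1 2 τ z + jTheta (-1) 2 τ z) := by
  have h1 := (summable_thetaTerm two_pos hτ z (1 / (2 * 2))).hasSum
  have h2 := (Equiv.addRight (1 : ℤ)).hasSum_iff.mpr
    (summable_thetaTerm two_pos hτ z (-1 / (2 * 2))).hasSum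
  rw [← jTheta_eq_tsum_thetaTerm] at h1 h2
  refine HasSum.int_even_add_odd ?_ ?_
  · convert h1 using 3
    push_cast
    ring
  · convert h2 using 3
    simp only [Function.comp_apply, Equiv.coe_addRight]
    congr 1
    push_cast
    ring

/-- The terms of the two sides agree along `latticeEquiv`. -/
theorem thetaTerm_mul_thetaTerm {m : ℝ} (hm : 0 < m) (k r p s : ℝ) (τ z : ℂ) :
    thetaTerm 2 τ z ((2 * (r + 2 * p - 2 * m * s - 1) + 1) / 4) *
        thetaTerm m τ z (k / (2 * m) + (p + 2 * s)) =
      thetaTerm (m + 2) τ z ((k - 1 + 2 * r) / (2 * (m + 2)) + p) *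
        thetaTerm (2 * m * (m + 2)) τ 0
          ((2 * k + m - 2 * m * r) / (2 * (2 * m * (m + 2))) + s) := by
  have h1 : (m : ℂ) ≠ 0 := by exact_mod_cast hm.ne'
  have h2 : (m : ℂ) + 2 ≠ 0 := by exact_mod_cast (by positivity : m + 2 ≠ 0)
  simp only [thetaTerm, ← Complex.exp_add]
  congr 1
  push_cast
  field_simp
  ring
/-- Formula (2.1d): `[θ_{1,2}+θ_{−1,2}]·θ_{k,m}`. -/
theorem stmt_18 (m : ℕ) (hm : 1 ≤ m) (k : ℝ) (hk : ∃ a : ℤ, k = a / 2)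
    (τ : ℂ) (hτ : 0 < τ.im) (z : ℂ) :
    (jTheta 1 2 τ z + jTheta (-1) 2 τ z) * jTheta k (m : ℝ) τ z =
      ∑ r ∈ Finset.range (2 * (m + 2)),
        jTheta (k - 1 + 2 * (r : ℝ)) ((m : ℝ) + 2) τ z *
          jTheta (2 * k + (m : ℝ) - 2 * (m : ℝ) * (r : ℝ)) (2 * (m : ℝ) * ((m : ℝ) + 2)) τ 0 := by
  have hm' : (0 : ℝ) < m := by exact_mod_cast hm
  have hodd := (hasSum_thetaTerm_odd hτ z).summable.norm
  have hk' := (summable_thetaTerm hm' hτ z (k / (2 * m))).norm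
  have hsum := (latticeEquiv m).summable_iff.mpr (summable_mul_of_summable_norm hodd hk')
  simp only [Function.comp_def] at hsum
  rw [← (hasSum_thetaTerm_odd hτ z).tsum_eq, jTheta_eq_tsum_thetaTerm,
    tsum_mul_tsum_of_summable_norm hodd hk', ← (latticeEquiv m).tsum_eq,
    hsum.tsum_prod, tsum_fintype,
    Finset.sum_range]
  refine Finset.sum_congr rfl fun r _ => ?_
  rw [jTheta_eq_tsum_thetaTerm, jTheta_eq_tsum_thetaTerm, tsum_mul_tsum_of_summable_norm
    (summable_thetaTerm (by positivity) hτ _ _).norm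
    (summable_thetaTerm (by positivity) hτ _ _).norm]
  refine tsum_congr fun x => ?_
  rw [← thetaTerm_mul_thetaTerm hm']
  simp [latticeEquiv]
end
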